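/- Every triangle-free finite simple graph G with |H_2(G)| ≥ |L_2(G)| + 4 contains two vertex-disjoint cycles. -/

import Mathlib

open Finset

/-- `G` contains `k` pairwise vertex-disjoint cycles. -/
def HasDisjointCycles {V : Type*} (G : SimpleGraph V) (k : ℕ) : Prop :=
  ∃ (v : Fin k → V) (c : ∀ i, G.Walk (v i) (v i)),
    (∀ i, (c i).IsCycle) ∧
    ∀ i j, i ≠ j → ∀ x, x ∈ (c i).support → x ∉ (c j).support

/-- `H_k(G)`: the set of vertices of degree at least `2k`. -/
def Hset {V : Type*} [Fintype V] (G : SimpleGraph V) [DecidableRel G.Adj] (k : ℕ) : Finset V :=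
  univ.filter fun v => 2 * k ≤ G.degree v

/-- `L_k(G)`: the set of vertices of degree at most `2k - 2`. -/
def Lset {V : Type*} [Fintype V] (G : SimpleGraph V) [DecidableRel G.Adj] (k : ℕ) : Finset V :=
  univ.filter fun v => G.degree v ≤ 2 * k - 2


section

open scoped Classical

variable {V : Type*}

/-- The number of neighbours of `v` inside `S`. -/
noncomputable def degIn (G : SimpleGraph V) (S : Finset V) (v : V) : ℕ :=
  (S.filter fun w => G.Adj v w).card

/-- `S` has a nonempty subset inducing a subgraph of minimum degree at least `2`. -/
def HasCore (G : SimpleGraph V) (S : Finset V) : Prop :=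
  ∃ T ⊆ S, T.Nonempty ∧ ∀ v ∈ T, 2 ≤ degIn G T v

/-- The contribution of a vertex of degree `d` to `|H_2| - |L_2|`. -/
def wt (d : ℕ) : ℤ := if d ≤ 2 then -1 else if d = 3 then 0 else 1

lemma wt_mono {a b : ℕ} (h : a ≤ b) : wt a ≤ wt b := by
  unfold wt; split_ifs <;> omega

lemma wt_le_one (a : ℕ) : wt a ≤ 1 := by
  unfold wt; split_ifs <;> omega

lemma wt_succ_le (a : ℕ) : wt (a + 1) ≤ wt a + 1 := by
  unfold wt; split_ifs <;> omega

variable {G : SimpleGraph V} {S T : Finset V} {a b c d v w : V}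

lemma degIn_mono (h : S ⊆ T) (v : V) : degIn G S v ≤ degIn G T v :=
  card_le_card (filter_subset_filter _ h)

lemma degIn_erase (ha : a ∈ S) (v : V) :
    degIn G S v = degIn G (S.erase a) v + if G.Adj v a then 1 else 0 := by
  unfold degIn
  rw [filter_erase]
  split_ifs with h
  · rw [card_erase_add_one (by simp [ha, h])]
  · rw [erase_eq_of_notMem (by simp [h]), add_zero]

lemma degIn_insert (ha : a ∉ S) (v : V) :
    degIn G (insert a S) v = degIn G S v + if G.Adj v a then 1 else 0 := by
  rw [degIn_erase (mem_insert_self a S), erase_insert ha]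

lemma degIn_erase_self (a : V) : degIn G (S.erase a) a = degIn G S a := by
  by_cases ha : a ∈ S
  · simp [degIn_erase ha]
  · rw [erase_eq_of_notMem ha]

lemma one_le_degIn (ha : a ∈ S) (h : G.Adj v a) : 1 ≤ degIn G S v :=
  card_pos.mpr ⟨a, by simp [ha, h]⟩

lemma two_le_degIn (ha : a ∈ S) (hb : b ∈ S) (hab : a ≠ b) (h : G.Adj v a) (h' : G.Adj v b) :
    2 ≤ degIn G S v :=
  one_lt_card.mpr ⟨a, by simp [ha, h], b, by simp [hb, h'], hab⟩

lemma exists_adj_of_degIn_pos (h : 1 ≤ degIn G S v) : ∃ a ∈ S, G.Adj v a := by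
  obtain ⟨a, ha⟩ := card_pos.mp (show 0 < (S.filter fun w => G.Adj v w).card from h)
  exact ⟨a, (mem_filter.mp ha).1, (mem_filter.mp ha).2⟩

lemma exists_adj_ne_of_two_le_degIn (h : 2 ≤ degIn G S v) (b : V) :
    ∃ a ∈ S, a ≠ b ∧ G.Adj v a := by
  obtain ⟨a, ha, hab⟩ := exists_mem_ne (show 1 < (S.filter fun w => G.Adj v w).card from h) b
  exact ⟨a, (mem_filter.mp ha).1, hab, (mem_filter.mp ha).2⟩

lemma eq_of_degIn_le_one (h : degIn G S v ≤ 1) (ha : a ∈ S) (hb : b ∈ S) (h1 : G.Adj v a)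
    (h2 : G.Adj v b) : a = b := by
  by_contra hab
  have := two_le_degIn ha hb hab h1 h2
  omega

lemma HasCore.mono (h : HasCore G S) (hST : S ⊆ T) : HasCore G T := by
  obtain ⟨U, hU, h⟩ := h
  exact ⟨U, hU.trans hST, h⟩

lemma hasCore_four_cycle (hab : G.Adj a b) (hbc : G.Adj b c) (hcd : G.Adj c d) (hda : G.Adj d a)
    (hac : a ≠ c) (hbd : b ≠ d) : HasCore G {a, b, c, d} := by
  refine ⟨_, Subset.rfl, ⟨a, by simp⟩, ?_⟩
  intro v hv
  simp only [mem_insert, mem_singleton] at hv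
  rcases hv with rfl | rfl | rfl | rfl
  · exact two_le_degIn (a := b) (b := d) (by simp) (by simp) hbd hab hda.symm
  · exact two_le_degIn (a := a) (b := c) (by simp) (by simp) hac hab.symm hbc
  · exact two_le_degIn (a := b) (b := d) (by simp) (by simp) hbd hbc.symm hcd
  · exact two_le_degIn (a := a) (b := c) (by simp) (by simp) hac hda hcd.symm

lemma sum_adj_eq_degIn (G : SimpleGraph V) (S : Finset V) (a : V) :
    (∑ v ∈ S, if G.Adj v a then 1 else 0) = degIn G S a := by
  rw [degIn, card_filter]
  simp only [G.adj_comm]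

lemma sum_degIn_erase (ha : a ∈ S) :
    ∑ v ∈ S, degIn G S v = ∑ v ∈ S.erase a, degIn G (S.erase a) v + 2 * degIn G S a := by
  rw [← add_sum_erase S _ ha, sum_congr rfl fun v _ => degIn_erase (G := G) ha v,
    sum_add_distrib, sum_adj_eq_degIn, degIn_erase_self]
  ring

lemma sum_degIn_insert (ha : a ∉ S) :
    ∑ v ∈ insert a S, degIn G (insert a S) v = ∑ v ∈ S, degIn G S v + 2 * degIn G S a := by
  rw [sum_degIn_erase (mem_insert_self a S), erase_insert ha, degIn_insert ha]
  simp

lemma hasCore_of_sum (hS : S.Nonempty) (h : 2 * S.card ≤ ∑ v ∈ S, degIn G S v) : HasCore G S := by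
  induction hn : S.card generalizing S with
  | zero => simp_all
  | succ n ih =>
    by_cases hdeg : ∀ v ∈ S, 2 ≤ degIn G S v
    · exact ⟨S, Subset.rfl, hS, hdeg⟩
    push Not at hdeg
    obtain ⟨v, hv, hlt⟩ := hdeg
    have h1 := sum_degIn_erase (G := G) hv
    have h2 := card_erase_of_mem hv
    have hne : (S.erase v).Nonempty := by
      rw [nonempty_iff_ne_empty]
      intro he
      have h0 : degIn G S v = 0 := by rw [← degIn_erase_self, he]; rfl
      rw [he] at h1
      simp at h1
      omega
    exact (ih hne (by omega) (by omega)).mono (erase_subset _ _)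

lemma sum_degIn_le (hS : S.Nonempty) (h : ¬ HasCore G S) :
    ∑ v ∈ S, degIn G S v + 2 ≤ 2 * S.card := by
  have h1 : Even (∑ v ∈ S, degIn G S v) := by
    clear hS h
    induction S using Finset.induction_on with
    | empty => simp
    | insert a S ha ih => rw [sum_degIn_insert ha]; exact ih.add (even_two_mul _)
  by_contra hlt
  refine h (hasCore_of_sum hS ?_)
  obtain ⟨r, hr⟩ := h1
  omega

/-- A set inducing minimum degree at least `2` contains the support of a cycle. -/
lemma HasCore.exists_cycle (h : HasCore G S) :
    ∃ (v : V) (p : G.Walk v v), p.IsCycle ∧ ∀ x ∈ p.support, x ∈ S := by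
  obtain ⟨T, hT, ⟨t, ht⟩, hdeg⟩ := h
  have hcyc : ¬ (G.induce (T : Set V)).IsAcyclic := by
    intro hac
    have : Nonempty (T : Set V) := ⟨⟨t, ht⟩⟩
    obtain ⟨u, v, p, hp, hmax⟩ :=
      SimpleGraph.Walk.exists_isPath_forall_isPath_length_le_length (G.induce (T : Set V))
    have key : ∀ w, (G.induce (T : Set V)).Adj v w → w = p.penultimate := by
      intro w hw
      refine hac.eq_penultimate_of_adj_end hp hw ?_
      by_contra hws
      have := hmax _ _ _ (hp.concat hws hw)
      simp at this
    obtain ⟨a, haT, hne, hadj⟩ := exists_adj_ne_of_two_le_degIn (hdeg v v.2) p.penultimate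
    exact hne (congrArg Subtype.val (key ⟨a, haT⟩ hadj))
  simp only [SimpleGraph.IsAcyclic, not_forall, not_not] at hcyc
  obtain ⟨v, p, hp⟩ := hcyc
  let f := (SimpleGraph.Embedding.induce (G := G) (T : Set V)).toHom
  refine ⟨f v, p.map f, hp.map Subtype.val_injective, ?_⟩
  intro x hx
  rw [SimpleGraph.Walk.support_map, List.mem_map] at hx
  obtain ⟨y, -, rfl⟩ := hx
  exact hT y.2

/-- Removing a light vertex with at most one neighbour does not decrease the total weight. -/
lemma sum_wt_erase (c : V → ℕ) (hv : v ∈ S) (h1 : degIn G S v ≤ 1) (h2 : degIn G S v + c v ≤ 2) :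
    ∑ w ∈ S, wt (degIn G S w + c w) ≤
      ∑ w ∈ S.erase v, wt (degIn G (S.erase v) w + c w) := by
  rw [← add_sum_erase S _ hv]
  have hle : ∀ w ∈ S.erase v, wt (degIn G S w + c w) ≤
      wt (degIn G (S.erase v) w + c w) + ((if G.Adj w v then 1 else 0 : ℕ) : ℤ) := by
    intro w _
    rw [degIn_erase hv w]
    split_ifs
    · rw [add_right_comm]; exact_mod_cast wt_succ_le _
    · simp
  have hs := sum_le_sum hle
  rw [sum_add_distrib, ← Nat.cast_sum, sum_adj_eq_degIn, degIn_erase_self] at hs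
  have hw : wt (degIn G S v + c v) = -1 := by simp [wt, h2]
  have : (degIn G S v : ℤ) ≤ 1 := by exact_mod_cast h1
  omega

/-- `P` becomes a set of minimum degree at least `2` after adding a vertex adjacent to `M`. -/
def IsLink (G : SimpleGraph V) (M P : Finset V) : Prop :=
  (∀ v ∈ P, 2 ≤ degIn G P v + if v ∈ M then 1 else 0) ∧ 2 ≤ (P.filter fun v => v ∈ M).card

lemma IsLink.hasCore {M P : Finset V} (h : IsLink G M P) {x : V} (hx : x ∉ P)
    (hM : ∀ m ∈ M, G.Adj x m) : HasCore G (insert x P) := by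
  refine ⟨_, Subset.rfl, insert_nonempty _ _, ?_⟩
  intro v hv
  rw [degIn_insert hx]
  rcases mem_insert.mp hv with rfl | hv
  · refine le_trans (h.2.trans (card_le_card ?_)) (Nat.le_add_right _ _)
    intro w hw
    simp only [mem_filter] at hw ⊢
    exact ⟨hw.1, hM w hw.2⟩
  · refine (h.1 v hv).trans (Nat.add_le_add_left ?_ _)
    split_ifs with h1 h2
    · exact le_rfl
    · exact absurd (hM v h1).symm h2
    · exact Nat.zero_le _
    · exact le_rfl

lemma isLink_pair {M : Finset V} (ha : a ∈ M) (hb : b ∈ M) (h : G.Adj a b) :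
    IsLink G M {a, b} := by
  constructor
  · intro v hv
    simp only [mem_insert, mem_singleton] at hv
    rcases hv with rfl | rfl
    · have := one_le_degIn (S := {v, b}) (by simp) h
      simp [ha]; omega
    · have := one_le_degIn (S := {a, v}) (by simp) h.symm
      simp [hb]; omega
  · exact one_lt_card.mpr ⟨a, by simp [ha], b, by simp [hb], h.ne⟩

/-- Moving a mark from a pendant vertex to its neighbour preserves links. -/
lemma IsLink.of_insert {M P : Finset V} {m p : V} (h : IsLink G (insert p M) P) (hm : m ∉ P)
    (hmM : m ∈ M) (hpM : p ∉ M) (hmp : G.Adj m p) :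
    ∃ Q, IsLink G M Q ∧ Q ⊆ insert m P ∧ (m ∈ Q → p ∈ P) := by
  by_cases hp : p ∈ P
  · refine ⟨insert m P, ⟨?_, ?_⟩, Subset.rfl, fun _ => hp⟩
    · intro v hv
      rw [degIn_insert hm]
      rcases mem_insert.mp hv with rfl | hv
      · have := one_le_degIn hp hmp
        simp [hmM]; omega
      · have h1 := h.1 v hv
        rcases eq_or_ne v p with rfl | hvp
        · simp [hpM, hmp.symm] at h1 ⊢
          omega
        · simp only [mem_insert, hvp, false_or] at h1
          omega
    · have h2 := h.2
      have hsub : insert p (P.filter fun v => v ∈ M) = P.filter fun v => v ∈ insert p M := by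
        ext v
        simp only [mem_insert, mem_filter]
        constructor
        · rintro (rfl | ⟨h1, h2⟩) <;> simp_all
        · tauto
      rw [← hsub, card_insert_of_notMem (by simp [hpM])] at h2
      rw [filter_insert, if_pos hmM, card_insert_of_notMem (by simp [hm])]
      exact h2
  · refine ⟨P, ⟨?_, ?_⟩, subset_insert _ _, fun h => absurd h hm⟩
    · intro v hv
      have h1 := h.1 v hv
      have hvp : v ≠ p := fun h => hp (h ▸ hv)
      simpa [hvp] using h1
    · have h2 := h.2
      rwa [filter_congr fun v hv => by
        rw [mem_insert, or_iff_right (fun h : v = p => hp (h ▸ hv))]] at h2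

/-- A forest of large total weight, where the marked vertices get a bonus, contains two disjoint
links. -/
lemma exists_disjoint_links {R M : Finset V} (hR : ¬ HasCore G R)
    (hsum : 2 ≤ ∑ v ∈ R, wt (degIn G R v + (1 + if v ∈ M then 1 else 0))) :
    ∃ P Q, P ⊆ R ∧ Q ⊆ R ∧ Disjoint P Q ∧ IsLink G M P ∧ IsLink G M Q := by
  induction hn : R.card generalizing R M with
  | zero =>
    rw [card_eq_zero] at hn
    simp [hn] at hsum
  | succ n ih =>
    by_cases h1 : ∃ v ∈ R, degIn G R v ≤ 1 ∧ degIn G R v + (1 + if v ∈ M then 1 else 0) ≤ 2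
    · obtain ⟨v, hv, hd, hd'⟩ := h1
      have hs := sum_wt_erase (fun v => 1 + if v ∈ M then 1 else 0) hv hd hd'
      obtain ⟨P, Q, hP, hQ, h⟩ := ih (R := R.erase v) (M := M)
        (fun h => hR (h.mono (erase_subset _ _))) (hsum.trans hs)
        (by rw [card_erase_of_mem hv, hn]; rfl)
      exact ⟨P, Q, hP.trans (erase_subset _ _), hQ.trans (erase_subset _ _), h⟩
    have hleaf : ∀ v ∈ R, degIn G R v ≤ 1 → v ∈ M ∧ degIn G R v = 1 := by
      intro v hv hd
      by_contra hcon
      refine h1 ⟨v, hv, hd, ?_⟩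
      split_ifs with hM
      · have : degIn G R v ≠ 1 := fun h => hcon ⟨hM, h⟩
        omega
      · omega
    by_cases h2 : ∃ m ∈ R, degIn G R m = 1 ∧ ∃ p ∈ R, G.Adj m p ∧ p ∉ M
    · obtain ⟨m, hm, hd, p, hp, hmp, hpM⟩ := h2
      have hmM := (hleaf m hm hd.le).1
      have hs : ∑ v ∈ R, wt (degIn G R v + (1 + if v ∈ M then 1 else 0)) =
          ∑ v ∈ R.erase m, wt (degIn G (R.erase m) v + (1 + if v ∈ insert p M then 1 else 0)) := by
        rw [← add_sum_erase R _ hm]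
        simp only [hd, hmM, if_true]
        rw [show wt (1 + (1 + 1)) = 0 from rfl, zero_add]
        refine sum_congr rfl fun v hv => congrArg wt ?_
        rw [degIn_erase hm v]
        rcases eq_or_ne v p with rfl | hvp
        · simp [hpM, hmp.symm, add_assoc]
        · have : ¬ G.Adj v m := fun h =>
            hvp (eq_of_degIn_le_one hd.le (erase_subset _ _ hv) hp h.symm hmp)
          simp [hvp, this]
      obtain ⟨P, Q, hP, hQ, hPQ, hlP, hlQ⟩ := ih (R := R.erase m) (M := insert p M)
        (fun h => hR (h.mono (erase_subset _ _))) (hsum.trans hs.le)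
        (by rw [card_erase_of_mem hm, hn]; rfl)
      have hmP : m ∉ P := fun h => by simpa using hP h
      have hmQ : m ∉ Q := fun h => by simpa using hQ h
      obtain ⟨P', hP', hPs, hPm⟩ := hlP.of_insert hmP hmM hpM hmp
      obtain ⟨Q', hQ', hQs, hQm⟩ := hlQ.of_insert hmQ hmM hpM hmp
      have hins : insert m (R.erase m) = R := insert_erase hm
      refine ⟨P', Q', (hPs.trans (insert_subset_insert m hP)).trans hins.le,
        (hQs.trans (insert_subset_insert m hQ)).trans hins.le, ?_, hP', hQ'⟩
      rw [disjoint_left] at hPQ ⊢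
      intro v hvP hvQ
      rcases eq_or_ne v m with rfl | hvm
      · exact hPQ (hPm hvP) (hQm hvQ)
      · exact hPQ (mem_of_mem_insert_of_ne (hPs hvP) hvm) (mem_of_mem_insert_of_ne (hQs hvQ) hvm)
    have hnb : ∀ m ∈ R, degIn G R m ≤ 1 → ∃ p ∈ R, G.Adj m p ∧ p ∈ M := by
      intro m hm hd
      have hd1 := (hleaf m hm hd).2
      obtain ⟨p, hp, hmp⟩ := exists_adj_of_degIn_pos hd1.ge
      refine ⟨p, hp, hmp, ?_⟩
      by_contra hpM
      exact h2 ⟨m, hm, hd1, p, hp, hmp, hpM⟩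
    have hne : R.Nonempty := card_pos.mp (by omega)
    obtain ⟨m, hm, hmd⟩ : ∃ m ∈ R, degIn G R m ≤ 1 := by
      by_contra! hcon
      exact hR ⟨R, Subset.rfl, hne, hcon⟩
    obtain ⟨p, hp, hmp, hpM⟩ := hnb m hm hmd
    by_cases h3 : ∃ m' ∈ R, degIn G R m' ≤ 1 ∧ m' ≠ p ∧ ¬ G.Adj m' p
    · obtain ⟨m', hm', hmd', hne', hnadj⟩ := h3
      obtain ⟨p', hp', hmp', hpM'⟩ := hnb m' hm' hmd'
      have e1 : m' ≠ m := by rintro rfl; exact hnadj hmp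
      have e2 : p' ≠ p := by rintro rfl; exact hnadj hmp'
      have e3 : p' ≠ m := by
        rintro rfl
        exact hne' (eq_of_degIn_le_one hmd hm' hp hmp'.symm hmp)
      refine ⟨{m, p}, {m', p'}, ?_, ?_, ?_, isLink_pair (hleaf m hm hmd).1 hpM hmp,
        isLink_pair (hleaf m' hm' hmd').1 hpM' hmp'⟩
      · simp [insert_subset_iff, hm, hp]
      · simp [insert_subset_iff, hm', hp']
      · simp [e1, e2, e3, hne']
    push Not at h3
    exfalso
    set Y := R.filter fun v => v ≠ p ∧ 2 ≤ degIn G R v with hY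
    have hYR : Y ⊆ R := filter_subset _ _
    have hpY : p ∉ Y := by simp [hY]
    have hins : insert p Y ⊆ R := insert_subset hp hYR
    have hYdeg : ∀ y ∈ Y, 2 ≤ degIn G (insert p Y) y := by
      intro y hy
      obtain ⟨hyR, hyp, hyd⟩ := mem_filter.mp hy
      refine hyd.trans (card_le_card ?_)
      intro w hw
      simp only [mem_filter, mem_insert] at hw ⊢
      refine ⟨?_, hw.2⟩
      by_contra! hcon
      have hwd : degIn G R w ≤ 1 := by
        by_contra! hlt
        exact hcon.2 (mem_filter.mpr ⟨hw.1, hcon.1, hlt⟩)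
      exact hyp (eq_of_degIn_le_one hwd hyR hp hw.2.symm (h3 w hw.1 hwd hcon.1))
    have hYe : Y = ∅ := by
      by_contra hYne
      have hYne := nonempty_iff_ne_empty.mpr hYne
      have hac : ¬ HasCore G (insert p Y) := fun h => hR (h.mono hins)
      have hle := sum_degIn_le (insert_nonempty _ _) hac
      rw [sum_insert hpY, card_insert_of_notMem hpY, degIn_insert hpY] at hle
      have hge : Y.card * 2 ≤ ∑ y ∈ Y, degIn G (insert p Y) y :=
        card_nsmul_le_sum Y (degIn G (insert p Y)) 2 hYdeg
      have h0 : degIn G Y p = 0 := by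
        simp only [SimpleGraph.irrefl, if_false] at hle
        omega
      refine hR ⟨Y, hYR, hYne, ?_⟩
      intro y hy
      have := hYdeg y hy
      rw [degIn_insert hpY, if_neg] at this
      · exact this
      · intro hadj
        have := one_le_degIn hy hadj.symm
        omega
    have hall : ∀ v ∈ R.erase p, wt (degIn G R v + (1 + if v ∈ M then 1 else 0)) ≤ 0 := by
      intro v hv
      obtain ⟨hvp, hvR⟩ := mem_erase.mp hv
      have hd : degIn G R v ≤ 1 := by
        by_contra! hlt
        have : v ∈ Y := mem_filter.mpr ⟨hvR, hvp, hlt⟩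
        simp [hYe] at this
      refine (wt_mono (b := 3) ?_).trans (by simp [wt])
      split_ifs <;> omega
    rw [← add_sum_erase R _ hp] at hsum
    have := sum_nonpos hall
    have := wt_le_one (degIn G R p + (1 + if p ∈ M then 1 else 0))
    omega

lemma mul_card_le_card_biUnion_of_disjoint {α : Type*} {M : Finset α} {N : α → Finset V} {k : ℕ}
    (hk : ∀ m ∈ M, k ≤ (N m).card)
    (hd : ∀ m ∈ M, ∀ m' ∈ M, m ≠ m' → ∀ p ∈ N m, p ∉ N m') :
    k * M.card ≤ (M.biUnion N).card := by
  rw [card_biUnion fun m hm m' hm' hne => disjoint_left.mpr fun p => hd m hm m' hm' hne p,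
    mul_comm, ← smul_eq_mul]
  exact card_nsmul_le_sum _ _ _ hk

/-- A lower bound for the size of the union of a linear family of sets of size at least `2` in
which any two disjoint pairs of members meet in the same point. -/
lemma card_biUnion_of_linear {α : Type*} {M : Finset α} {N : α → Finset V}
    (h2 : ∀ m ∈ M, 2 ≤ (N m).card)
    (h1 : ∀ m ∈ M, ∀ m' ∈ M, m ≠ m' → ∀ p q, p ∈ N m → p ∈ N m' → q ∈ N m → q ∈ N m' → p = q)
    (h4 : ∀ m₁ ∈ M, ∀ m₂ ∈ M, ∀ m₃ ∈ M, ∀ m₄ ∈ M, m₁ ≠ m₂ → m₁ ≠ m₃ → m₁ ≠ m₄ → m₂ ≠ m₃ →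
      m₂ ≠ m₄ → m₃ ≠ m₄ → ∀ p q, p ∈ N m₁ → p ∈ N m₂ → q ∈ N m₃ → q ∈ N m₄ → p = q) :
    M.card + 1 ≤ (M.biUnion N).card ∨ 2 * M.card ≤ (M.biUnion N).card + 3 := by
  by_cases hI : ∃ m₁ ∈ M, ∃ m₂ ∈ M, ∃ m₃ ∈ M, m₁ ≠ m₂ ∧ m₁ ≠ m₃ ∧ m₂ ≠ m₃ ∧
      ∃ p a, p ∈ N m₁ ∧ p ∈ N m₂ ∧ a ∈ N m₁ ∧ a ∈ N m₃ ∧ p ≠ a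
  · right
    obtain ⟨m₁, hm₁, m₂, hm₂, m₃, hm₃, h12, h13, h23, p, a, hp1, hp2, ha1, ha3, hpa⟩ := hI
    set O := ((M.erase m₁).erase m₂).erase m₃ with hO
    have hOc : M.card = O.card + 3 := by
      rw [hO, card_erase_of_mem (by simp [hm₃, h23.symm, h13.symm]),
        card_erase_of_mem (by simp [hm₂, h12.symm]), card_erase_of_mem hm₁]
      have : ({m₁, m₂, m₃} : Finset α) ⊆ M := by
        intro x; simp only [mem_insert, mem_singleton]; rintro (rfl | rfl | rfl) <;> assumption
      have := card_le_card this
      rw [card_eq_three.mpr ⟨m₁, m₂, m₃, h12, h13, h23, rfl⟩] at this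
      omega
    have hOm : ∀ {i}, i ∈ O → i ∈ M ∧ i ≠ m₁ ∧ i ≠ m₂ ∧ i ≠ m₃ := by
      intro i hi; simp only [hO, mem_erase] at hi; tauto
    have hu : 2 * O.card ≤ (O.biUnion N).card := by
      refine mul_card_le_card_biUnion_of_disjoint (fun m hm => h2 m (hOm hm).1) ?_
      intro i hi j hj hij q hqi hqj
      obtain ⟨hi, hi1, hi2, hi3⟩ := hOm hi
      obtain ⟨hj, hj1, hj2, hj3⟩ := hOm hj
      have e1 := h4 m₁ hm₁ m₂ hm₂ i hi j hj h12 hi1.symm hj1.symm hi2.symm hj2.symm hij p q hp1 hp2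
        hqi hqj
      have e2 := h4 m₁ hm₁ m₃ hm₃ i hi j hj h13 hi1.symm hj1.symm hi3.symm hj3.symm hij a q ha1 ha3
        hqi hqj
      exact hpa (e1.trans e2.symm)
    have hd : Disjoint (O.biUnion N) (N m₂ ∪ N m₃) := by
      rw [disjoint_left]
      intro q hq hq'
      obtain ⟨i, hi, hqi⟩ := mem_biUnion.mp hq
      obtain ⟨hi, hi1, hi2, hi3⟩ := hOm hi
      rcases mem_union.mp hq' with hq2 | hq3
      · have e := h4 m₁ hm₁ m₃ hm₃ m₂ hm₂ i hi h13 h12 hi1.symm h23.symm hi3.symm hi2.symm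
          a q ha1 ha3 hq2 hqi
        subst e
        exact hpa (h1 m₁ hm₁ m₂ hm₂ h12 p a hp1 hp2 ha1 hq2)
      · have e := h4 m₁ hm₁ m₂ hm₂ m₃ hm₃ i hi h12 h13 hi1.symm h23 hi2.symm hi3.symm
          p q hp1 hp2 hq3 hqi
        subst e
        exact hpa (h1 m₁ hm₁ m₃ hm₃ h13 p a hp1 hq3 ha1 ha3)
    have h3 : 3 ≤ (N m₂ ∪ N m₃).card := by
      have e1 := card_union_add_card_inter (N m₂) (N m₃)
      have e2 : (N m₂ ∩ N m₃).card ≤ 1 := card_le_one.mpr fun x hx y hy => by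
        rw [mem_inter] at hx hy
        exact h1 m₂ hm₂ m₃ hm₃ h23 x y hx.1 hx.2 hy.1 hy.2
      have := h2 m₂ hm₂
      have := h2 m₃ hm₃
      omega
    have hsub : (O.biUnion N) ∪ (N m₂ ∪ N m₃) ⊆ M.biUnion N := by
      refine union_subset (biUnion_subset_biUnion_of_subset_left N fun i hi => (hOm hi).1)
        (union_subset (subset_biUnion_of_mem N hm₂) (subset_biUnion_of_mem N hm₃))
    have := card_le_card hsub
    rw [card_union_of_disjoint hd] at this
    omega
  by_cases hdis : ∀ m ∈ M, ∀ m' ∈ M, m ≠ m' → ∀ p ∈ N m, p ∉ N m'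
  · right
    have := mul_card_le_card_biUnion_of_disjoint h2 hdis
    omega
  left
  push Not at hI hdis
  obtain ⟨m₁, hm₁, m₂, hm₂, h12, p, hp1, hp2⟩ := hdis
  have hall : ∀ i ∈ M, ∀ j ∈ M, i ≠ j → ∀ q, q ∈ N i → q ∈ N j → q = p := by
    intro i hi j hj hij q hqi hqj
    by_cases e1 : m₁ = i
    · subst e1
      by_cases e : m₂ = j
      · subst e
        exact h1 m₁ hm₁ m₂ hm₂ h12 q p hqi hqj hp1 hp2
      · exact hI m₁ hi j hj m₂ hm₂ hij h12 (Ne.symm e) q p hqi hqj hp1 hp2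
    by_cases e2 : m₁ = j
    · subst e2
      by_cases e : m₂ = i
      · subst e
        exact h1 m₁ hm₁ m₂ hm₂ h12 q p hqj hqi hp1 hp2
      · exact hI m₁ hj i hi m₂ hm₂ hij.symm h12 (Ne.symm e) q p hqj hqi hp1 hp2
    by_cases e3 : m₂ = i
    · subst e3
      exact hI m₂ hi j hj m₁ hm₁ hij h12.symm (Ne.symm e2) q p hqi hqj hp2 hp1
    by_cases e4 : m₂ = j
    · subst e4
      exact hI m₂ hj i hi m₁ hm₁ hij.symm h12.symm (Ne.symm e1) q p hqj hqi hp2 hp1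
    exact (h4 m₁ hm₁ m₂ hm₂ i hi j hj h12 e1 e2 e3 e4 hij p q hp1 hp2 hqi hqj).symm
  have hd : 1 * M.card ≤ (M.biUnion fun m => (N m).erase p).card := by
    refine mul_card_le_card_biUnion_of_disjoint (fun m hm => ?_) ?_
    · have := h2 m hm
      have := pred_card_le_card_erase (s := N m) (a := p)
      omega
    · intro i hi j hj hij q hqi hqj
      rw [mem_erase] at hqi hqj
      exact hqi.1 (hall i hi j hj hij q hqi.2 hqj.2)
  have hp : p ∉ M.biUnion fun m => (N m).erase p := by simp
  have hsub : insert p (M.biUnion fun m => (N m).erase p) ⊆ M.biUnion N := by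
    refine insert_subset (mem_biUnion.mpr ⟨m₁, hm₁, hp1⟩) (biUnion_subset.mpr fun m hm => ?_)
    exact (erase_subset _ _).trans (subset_biUnion_of_mem N hm)
  have := card_le_card hsub
  rw [card_insert_of_notMem hp] at this
  omega

/-- The graph obtained from `G` by contracting the edge `uv` onto `u`, restricted to `R`. -/
def contractOnto (G : SimpleGraph V) (R : Finset V) (u v : V) : SimpleGraph V where
  Adj a b := a ≠ b ∧ a ∈ R ∧ b ∈ R ∧ (G.Adj a b ∨ (a = u ∧ G.Adj v b) ∨ (b = u ∧ G.Adj v a))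
  symm := ⟨fun a b h => by
    obtain ⟨h1, h2, h3, h4⟩ := h
    exact ⟨h1.symm, h3, h2, by rw [G.adj_comm]; tauto⟩⟩
  loopless := ⟨fun a h => h.1 rfl⟩

section contractOnto

variable {R : Finset V} {u : V}

lemma contractOnto_adj_of_ne (ha : a ∈ R) (hb : b ∈ R) (hau : a ≠ u) (hbu : b ≠ u) :
    (contractOnto G R u v).Adj a b ↔ G.Adj a b := by
  simp only [contractOnto, hau, hbu, ha, hb, false_and, or_false, true_and]
  exact ⟨fun h => h.2, fun h => ⟨h.ne, h⟩⟩

lemma contractOnto_adj_left (hu : u ∈ R) (ha : a ∈ R) (hau : a ≠ u) :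
    (contractOnto G R u v).Adj u a ↔ G.Adj u a ∨ G.Adj v a := by
  simp only [contractOnto, hau, hau.symm, ha, hu, ne_eq, not_false_eq_true, true_and, false_and,
    or_false]

lemma degIn_contractOnto_of_notMem (hT : T ⊆ R) (hu : u ∉ T) (ha : a ∈ R) (hau : a ≠ u) :
    degIn (contractOnto G R u v) T a = degIn G T a := by
  unfold degIn
  congr 1
  refine filter_congr fun w hw => ?_
  exact contractOnto_adj_of_ne ha (hT hw) hau fun h => hu (h ▸ hw)

lemma degIn_contractOnto_le (hT : T ⊆ R) (huR : u ∈ R) (hu : u ∉ T) :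
    degIn (contractOnto G R u v) T u ≤ degIn G T u + degIn G T v := by
  unfold degIn
  refine le_trans (card_le_card ?_) (card_union_le _ _)
  intro w hw
  simp only [mem_filter, mem_union] at hw ⊢
  have := (contractOnto_adj_left huR (hT hw.1) fun h => hu (h ▸ hw.1)).mp hw.2
  tauto

lemma le_degIn_contractOnto (hT : T ⊆ R) (huR : u ∈ R) (hu : u ∉ T)
    (h : ∀ w ∈ T, G.Adj u w → ¬ G.Adj v w) :
    degIn G T u + degIn G T v ≤ degIn (contractOnto G R u v) T u := by
  unfold degIn
  rw [← card_union_of_disjoint]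
  · refine card_le_card fun w hw => ?_
    simp only [mem_filter, mem_union] at hw ⊢
    rcases hw with ⟨hw, h1⟩ | ⟨hw, h1⟩
    · exact ⟨hw, (contractOnto_adj_left huR (hT hw) fun h => hu (h ▸ hw)).mpr (.inl h1)⟩
    · exact ⟨hw, (contractOnto_adj_left huR (hT hw) fun h => hu (h ▸ hw)).mpr (.inr h1)⟩
  · rw [disjoint_left]
    intro w h1 h2
    rw [mem_filter] at h1 h2
    exact h w h1.1 h1.2 h2.2

/-- Cores of a contracted graph lift to the original graph. -/
lemma HasCore.of_contractOnto (hv : v ∉ R) (hu : u ∈ R) (huv : G.Adj u v) (hT : T ⊆ R)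
    (h : HasCore (contractOnto G R u v) T) :
    HasCore G (if u ∈ T then insert v T else T) := by
  obtain ⟨U, hUT, hne, hdeg⟩ := h
  have hvU : v ∉ U := fun h => hv (hT (hUT h))
  have huv' := huv.symm
  by_cases huU : u ∈ U
  swap
  · refine HasCore.mono (S := U) ⟨U, Subset.rfl, hne, fun w hw => ?_⟩ (by
      split_ifs
      · exact hUT.trans (subset_insert _ _)
      · exact hUT)
    rw [← degIn_contractOnto_of_notMem (hUT.trans hT) huU (hT (hUT hw)) fun h => huU (h ▸ hw)]
    exact hdeg w hw
  rw [if_pos (hUT huU)]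
  have hsub := hUT.trans hT
  have hsub' : U.erase u ⊆ R := (erase_subset _ _).trans hsub
  have hvU' : v ∉ U.erase u := fun h => hvU (mem_of_mem_erase h)
  have hw : ∀ w ∈ U.erase u, 2 ≤ degIn G (U.erase u) w + (if G.Adj w u then 1 else 0) +
      (if G.Adj w v then 1 else 0) := by
    intro w hw
    rw [mem_erase] at hw
    have := hdeg w hw.2
    rw [degIn_erase huU, degIn_contractOnto_of_notMem hsub' (by simp) (hsub hw.2) hw.1] at this
    have e := contractOnto_adj_left (G := G) (v := v) hu (hsub hw.2) hw.1
    rw [SimpleGraph.adj_comm, G.adj_comm u, G.adj_comm v] at e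
    split_ifs at this ⊢ <;> first | omega | tauto
  have hu2 : 2 ≤ degIn G (U.erase u) u + degIn G (U.erase u) v := by
    refine le_trans ?_ (degIn_contractOnto_le hsub' hu (by simp))
    rw [degIn_erase_self]
    exact hdeg u huU
  by_cases hv0 : degIn G (U.erase u) v = 0
  · refine HasCore.mono (S := U) ⟨U, Subset.rfl, hne, fun w hwU => ?_⟩
      (hUT.trans (subset_insert _ _))
    rcases eq_or_ne w u with rfl | hwu
    · rw [degIn_erase_self] at hu2; omega
    · have h1 := hw w (by simp [hwU, hwu])
      have h2 : ¬ G.Adj w v := fun h => by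
        have := one_le_degIn (G := G) (S := U.erase u) (by simp [hwU, hwu]) h.symm
        omega
      rw [if_neg h2] at h1
      rw [degIn_erase huU]
      omega
  by_cases hu0 : degIn G (U.erase u) u = 0
  · refine HasCore.mono (S := insert v (U.erase u)) ⟨_, Subset.rfl, by simp, fun w hwU => ?_⟩
      (insert_subset_insert _ ((erase_subset _ _).trans hUT))
    rw [degIn_insert hvU']
    rcases mem_insert.mp hwU with rfl | hwU
    · omega
    · have h1 := hw w hwU
      have h2 : ¬ G.Adj w u := fun h => by
        have := one_le_degIn (G := G) hwU h.symm
        omega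
      rw [if_neg h2] at h1
      omega
  · refine HasCore.mono (S := insert v U) ⟨_, Subset.rfl, by simp, fun w hwU => ?_⟩
      (insert_subset_insert _ hUT)
    rw [degIn_insert hvU, degIn_erase huU]
    rcases mem_insert.mp hwU with rfl | hwU
    · rw [if_pos huv']; omega
    · rcases eq_or_ne w u with rfl | hwu
      · rw [if_pos huv]; omega
      · exact hw w (by simp [hwU, hwu])

/-- In a triangle-free graph without `4`-cycles, contracting an edge at a vertex of degree at most
`3` preserves the hypotheses of the main theorem. -/
lemma contractOnto_spec (htri : ∀ a b c, G.Adj a b → G.Adj b c → ¬ G.Adj c a)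
    (h4 : ∀ a ∈ S, ∀ b ∈ S, ∀ c ∈ S, ∀ d ∈ S, G.Adj a b → G.Adj b c → G.Adj c d → G.Adj d a →
      a ≠ c → b = d) (hu : u ∈ S) (hv : v ∈ S) (huv : G.Adj u v)
    (hdeg : ∀ w ∈ S, 2 ≤ degIn G S w) (hsum : 4 ≤ ∑ w ∈ S, wt (degIn G S w))
    (hd : degIn G S u ≤ 3 ∨ ∀ w ∈ S, 4 ≤ degIn G S w) :
    (∀ a b c, (contractOnto G (S.erase v) u v).Adj a b → (contractOnto G (S.erase v) u v).Adj b c →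
      ¬ (contractOnto G (S.erase v) u v).Adj c a) ∧
    4 ≤ ∑ w ∈ S.erase v, wt (degIn (contractOnto G (S.erase v) u v) (S.erase v) w) := by
  have huR : u ∈ S.erase v := by simp [hu, huv.ne]
  set H := contractOnto G (S.erase v) u v with hH
  have key : ∀ b c, H.Adj u b → H.Adj b c → ¬ H.Adj c u := by
    intro b c h1 h2 h3
    have hbu := h1.1.symm
    have hcu := h3.1
    have hb := h1.2.2.1
    have hc := h2.2.2.1
    have hbS := mem_erase.mp hb
    have hcS := mem_erase.mp hc
    replace h3 := (contractOnto_adj_left huR hc hcu).mp h3.symm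
    replace h1 := (contractOnto_adj_left huR hb hbu).mp h1
    replace h2 := (contractOnto_adj_of_ne hb hc hbu hcu).mp h2
    rcases h1 with h1 | h1 <;> rcases h3 with h3 | h3
    · exact htri u b c h1 h2 h3.symm
    · exact hbS.1 (h4 u hu b hbS.2 c hcS.2 v hv h1 h2 h3.symm huv.symm hcu.symm)
    · exact hcS.1 (h4 u hu c hcS.2 b hbS.2 v hv h3 h2.symm h1.symm huv.symm hbu.symm)
    · exact htri v b c h1 h2 h3.symm
  constructor
  · intro a b c hab hbc hca
    by_cases ha : a = u
    · subst ha; exact key b c hab hbc hca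
    by_cases hb : b = u
    · subst hb; exact key c a hbc hca hab
    by_cases hc : c = u
    · subst hc; exact key a b hca hab hbc
    exact htri a b c ((contractOnto_adj_of_ne hab.2.1 hab.2.2.1 ha hb).mp hab)
      ((contractOnto_adj_of_ne hbc.2.1 hbc.2.2.1 hb hc).mp hbc)
      ((contractOnto_adj_of_ne hca.2.1 hca.2.2.1 hc ha).mp hca)
  have hA : ∀ w ∈ (S.erase v).erase u, degIn G S w ≤ degIn H (S.erase v) w := by
    intro w hw
    have hwu := (mem_erase.mp hw).1
    have hwR := (mem_erase.mp hw).2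
    have hwS := (mem_erase.mp hwR).2
    rw [degIn_erase hv, degIn_erase huR, degIn_erase (G := H) huR,
      degIn_contractOnto_of_notMem (erase_subset _ _) (by simp) hwR hwu]
    have e := contractOnto_adj_left (G := G) (v := v) huR hwR hwu
    rw [SimpleGraph.adj_comm, G.adj_comm u, G.adj_comm v] at e
    have := htri w u v
    have := huv
    have := G.adj_comm v w
    split_ifs <;> first | omega | tauto
  have hB : degIn G S u + degIn G S v ≤ degIn H (S.erase v) u + 2 := by
    have := le_degIn_contractOnto (G := G) (v := v) (R := S.erase v) (T := (S.erase v).erase u)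
      (erase_subset _ _) huR (by simp) (fun w _ h1 h2 => htri u w v h1 h2.symm huv.symm)
    rw [degIn_erase_self, degIn_erase_self, ← hH] at this
    rw [degIn_erase hv u, ← degIn_erase_self v, degIn_erase huR v, if_pos huv, if_pos huv.symm]
    omega
  rw [← add_sum_erase S _ hv, ← add_sum_erase (S.erase v) _ huR] at hsum
  rw [← add_sum_erase (S.erase v) _ huR]
  have hdu := hdeg u hu
  have hdv := hdeg v hv
  rcases hd with hd | hd
  · have h1 := sum_le_sum fun w hw => wt_mono (hA w hw)
    have h2 : wt (degIn G S v) + wt (degIn G S u) ≤ wt (degIn H (S.erase v) u) := by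
      unfold wt
      split_ifs <;> omega
    omega
  · have h1 : ∀ w ∈ (S.erase v).erase u, (1 : ℤ) ≤ wt (degIn H (S.erase v) w) := by
      intro w hw
      have h1 := hA w hw
      have h2 := hd w (mem_of_mem_erase (mem_of_mem_erase hw))
      unfold wt
      split_ifs <;> omega
    have h2 : 1 ≤ wt (degIn H (S.erase v) u) := by
      have h1 := hd u hu
      have h2 := hd v hv
      unfold wt
      split_ifs <;> omega
    have h3 := sum_le_sum h1
    have h4 : 3 ≤ ((S.erase v).erase u).card := by
      have h1 := hd u hu
      rw [degIn_erase hv, if_pos huv, ← degIn_erase_self] at h1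
      have : degIn G ((S.erase v).erase u) u ≤ ((S.erase v).erase u).card :=
        card_le_card (filter_subset _ _)
      omega
    simp only [sum_const, nsmul_eq_mul, mul_one] at h3
    omega

end contractOnto

/-- A `4`-cycle `c₁c₂c₃c₄`, a vertex `u` adjacent to `c₁, c₃` and a vertex `v` adjacent to
`c₂, c₄`, attached to a set `F` inducing a tree-like graph as sparsely as possible. -/
structure IsTightConfig (G : SimpleGraph V) (F : Finset V) (c₁ c₂ c₃ c₄ u v : V) : Prop where
  h12 : G.Adj c₁ c₂
  h23 : G.Adj c₂ c₃
  h34 : G.Adj c₃ c₄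
  h41 : G.Adj c₄ c₁
  h13 : c₁ ≠ c₃
  h24 : c₂ ≠ c₄
  n1 : c₁ ∉ F
  n2 : c₂ ∉ F
  n3 : c₃ ∉ F
  n4 : c₄ ∉ F
  hu : u ∈ F
  hv : v ∈ F
  u1 : G.Adj u c₁
  u3 : G.Adj u c₃
  v2 : G.Adj v c₂
  v4 : G.Adj v c₄
  u_unique : ∀ w ∈ F, G.Adj w c₁ → G.Adj w c₃ → w = u
  v_unique : ∀ w ∈ F, G.Adj w c₂ → G.Adj w c₄ → w = v
  sum_eq : ∑ w ∈ F, degIn G F w + 2 = 2 * F.card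
  d1 : 2 ≤ degIn G F c₁
  d2 : 2 ≤ degIn G F c₂
  d3 : 2 ≤ degIn G F c₃
  d4 : 2 ≤ degIn G F c₄
  degIn_le : ∀ w ∈ F, degIn G F w ≤ 3
  exists_adj : ∀ w ∈ F, G.Adj w c₁ ∨ G.Adj w c₂ ∨ G.Adj w c₃ ∨ G.Adj w c₄
  du : degIn G F u ≤ 2
  dv : degIn G F v ≤ 2
  du' : 1 ≤ degIn G F u
  dv' : 1 ≤ degIn G F v

namespace IsTightConfig

variable {F : Finset V} {c₁ c₂ c₃ c₄ u : V}

lemma rotate (h : IsTightConfig G F c₁ c₂ c₃ c₄ u v) : IsTightConfig G F c₂ c₃ c₄ c₁ v u :=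
  ⟨h.h23, h.h34, h.h41, h.h12, h.h24, h.h13.symm, h.n2, h.n3, h.n4, h.n1, h.hv, h.hu, h.v2, h.v4,
    h.u3, h.u1, h.v_unique, fun w hw h3 h1 => h.u_unique w hw h1 h3, h.sum_eq, h.d2, h.d3, h.d4,
    h.d1, h.degIn_le, fun w hw => by have := h.exists_adj w hw; tauto, h.dv, h.du, h.dv', h.du'⟩

lemma reflect (h : IsTightConfig G F c₁ c₂ c₃ c₄ u v) : IsTightConfig G F c₁ c₄ c₃ c₂ u v :=
  ⟨h.h41.symm, h.h34.symm, h.h23.symm, h.h12.symm, h.h13, h.h24.symm, h.n1, h.n4, h.n3, h.n2, h.hu,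
    h.hv, h.u1, h.u3, h.v4, h.v2, h.u_unique, fun w hw h3 h1 => h.v_unique w hw h1 h3, h.sum_eq,
    h.d1, h.d4, h.d3, h.d2, h.degIn_le, fun w hw => by have := h.exists_adj w hw; tauto, h.du, h.dv,
    h.du', h.dv'⟩

/-- A neighbour of `u` in `F` is adjacent to `c₂` or `c₄`. -/
lemma adj_of_adj (h : IsTightConfig G F c₁ c₂ c₃ c₄ u v)
    (htri : ∀ a b c, G.Adj a b → G.Adj b c → ¬ G.Adj c a) (hw : w ∈ F) (huw : G.Adj u w) :
    G.Adj w c₂ ∨ G.Adj w c₄ := by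
  rcases h.exists_adj w hw with h1 | h1 | h1 | h1
  · exact absurd h.u1.symm (htri u w c₁ huw h1)
  · exact .inl h1
  · exact absurd h.u3.symm (htri u w c₃ huw h1)
  · exact .inr h1

lemma false_of_pendant (h : IsTightConfig G F c₁ c₂ c₃ c₄ u v)
    (htri : ∀ a b c, G.Adj a b → G.Adj b c → ¬ G.Adj c a)
    (hFS : F ⊆ S) (s1 : c₁ ∈ S) (s2 : c₂ ∈ S) (s3 : c₃ ∈ S) (s4 : c₄ ∈ S)
    (hno : ∀ A ⊆ S, ∀ B ⊆ S, Disjoint A B → HasCore G A → ¬ HasCore G B)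
    (hpend : ∀ w ∈ F, G.Adj v w → w = u) : False := by
  have hvu : G.Adj v u := by
    obtain ⟨w, hw, hvw⟩ := exists_adj_of_degIn_pos h.dv'
    exact hpend w hw hvw ▸ hvw
  have hdv : degIn G F v ≤ 1 := by
    by_contra hlt
    obtain ⟨w, hw, hwu, hvw⟩ := exists_adj_ne_of_two_le_degIn (show 2 ≤ degIn G F v by omega) u
    exact hwu (hpend w hw hvw)
  have e1 := sum_degIn_erase (G := G) h.hv
  have f1 := card_erase_add_one h.hv
  have huv : u ∈ F.erase v := by simp [h.hu, hvu.ne']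
  have e2 := sum_degIn_erase (G := G) huv
  have f2 := card_erase_add_one huv
  have hs := h.sum_eq
  by_cases hex : ∃ w ∈ F, w ≠ v ∧ G.Adj u w
  swap
  · have hdu : degIn G (F.erase v) u = 0 := by
      by_contra hne
      obtain ⟨w, hw, huw⟩ := exists_adj_of_degIn_pos (show 1 ≤ degIn G (F.erase v) u by omega)
      rw [mem_erase] at hw
      exact hex ⟨w, hw.2, hw.1, huw⟩
    obtain ⟨w, hw, hwu, hw1⟩ := exists_adj_ne_of_two_le_degIn h.d1 u
    have hwv : w ≠ v := by
      rintro rfl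
      exact htri c₁ w c₂ hw1 h.v2 h.h12.symm
    refine hno ((F.erase v).erase u) ?_ {c₁, c₂, c₃, c₄} ?_ ?_
      (hasCore_of_sum ⟨w, by simp [hw, hwu, hwv]⟩ (by omega))
      (hasCore_four_cycle h.h12 h.h23 h.h34 h.h41 h.h13 h.h24)
    · exact (erase_subset _ _).trans ((erase_subset _ _).trans hFS)
    · simp only [insert_subset_iff, singleton_subset_iff]
      exact ⟨s1, s2, s3, s4⟩
    · simp [h.n1, h.n2, h.n3, h.n4]
  obtain ⟨u', hu', hu'v, huu'⟩ := hex
  have main : ∀ b b', IsTightConfig G F c₁ b c₃ b' u v → G.Adj u' b → b ∈ S → b' ∈ S → False := by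
    clear h
    intro b b' h hb sb sb'
    have hb' : ¬ G.Adj u' b' := fun hb' => hu'v (h.v_unique u' hu' hb hb')
    have hu'F : u' ∈ (F.erase v).erase u := by simp [hu', hu'v, huu'.ne']
    have e3 := sum_degIn_erase (G := G) hu'F
    have f3 := card_erase_add_one hu'F
    have hd1 : degIn G (F.erase v) u ≤ 1 := by
      have := h.du
      rw [degIn_erase h.hv, if_pos hvu.symm] at this
      omega
    have hd2 : degIn G ((F.erase v).erase u) u' ≤ 2 := by
      have h1 := h.degIn_le u' hu'
      have h2 := degIn_mono (G := G) (erase_subset v F) u'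
      rw [degIn_erase huv, if_pos huu'.symm] at h2
      omega
    set K := ((F.erase v).erase u).erase u' with hK
    have hKF : K ⊆ F := (erase_subset _ _).trans ((erase_subset _ _).trans (erase_subset _ _))
    have hc : ∀ c, c = c₁ ∨ c = c₃ → ∃ w ∈ K, G.Adj c w := by
      intro c hc
      have h2 : 2 ≤ degIn G F c := by rcases hc with rfl | rfl <;> [exact h.d1; exact h.d3]
      have hcu : G.Adj u c := by rcases hc with rfl | rfl <;> [exact h.u1; exact h.u3]
      have hcb : G.Adj b c := by rcases hc with rfl | rfl <;> [exact h.h12.symm; exact h.h23]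
      obtain ⟨w, hw, hwu, hcw⟩ := exists_adj_ne_of_two_le_degIn h2 u
      refine ⟨w, ?_, hcw⟩
      simp only [hK, mem_erase]
      refine ⟨?_, hwu, ?_, hw⟩
      · rintro rfl; exact htri u c w hcu hcw huu'.symm
      · rintro rfl; exact htri w b c h.v2 hcb hcw
    have hcb : ∃ w ∈ K, G.Adj b' w := by
      obtain ⟨w, hw, hwv, hbw⟩ := exists_adj_ne_of_two_le_degIn h.d4 v
      refine ⟨w, ?_, hbw⟩
      simp only [hK, mem_erase]
      refine ⟨?_, ?_, hwv, hw⟩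
      · rintro rfl; exact hb' hbw.symm
      · rintro rfl; exact htri w c₁ b' h.u1 h.h41.symm hbw
    obtain ⟨w1, hw1, hcw1⟩ := hc c₁ (.inl rfl)
    obtain ⟨w3, hw3, hcw3⟩ := hc c₃ (.inr rfl)
    obtain ⟨wb, hwb, hbwb⟩ := hcb
    have g1 : b' ∉ K := fun hh => h.n4 (hKF hh)
    have g2 : c₁ ∉ insert b' K := by
      simp only [mem_insert, not_or]
      exact ⟨h.h41.ne', fun hh => h.n1 (hKF hh)⟩
    have g3 : c₃ ∉ insert c₁ (insert b' K) := by
      simp only [mem_insert, not_or]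
      exact ⟨h.h13.symm, h.h34.ne, fun hh => h.n3 (hKF hh)⟩
    have i1 := sum_degIn_insert (G := G) g1
    have i2 := sum_degIn_insert (G := G) g2
    have i3 := sum_degIn_insert (G := G) g3
    have j1 := one_le_degIn hwb hbwb
    have j2 : 2 ≤ degIn G (insert b' K) c₁ :=
      two_le_degIn (mem_insert_self _ _) (mem_insert_of_mem hw1) (fun e => g1 (e ▸ hw1))
        h.h41.symm hcw1
    have j3 : 2 ≤ degIn G (insert c₁ (insert b' K)) c₃ :=
      two_le_degIn (a := b') (b := w3) (by simp) (by simp [hw3]) (fun e => g1 (e ▸ hw3))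
        h.h34 hcw3
    have k1 := card_insert_of_notMem g1
    have k2 := card_insert_of_notMem g2
    have k3 := card_insert_of_notMem g3
    refine hno {v, u, u', b} ?_ (insert c₃ (insert c₁ (insert b' K))) ?_ ?_
      (hasCore_four_cycle hvu huu' hb h.v2.symm hu'v.symm fun e => h.n2 (e ▸ h.hu))
      (hasCore_of_sum (insert_nonempty _ _) (by omega))
    · simp only [insert_subset_iff, singleton_subset_iff]
      exact ⟨hFS h.hv, hFS h.hu, hFS hu', sb⟩
    · simp only [insert_subset_iff]
      exact ⟨s3, s1, sb', hKF.trans hFS⟩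
    · have ne : ∀ {x y}, x ∈ F → y ∉ F → x ≠ y := fun hx hy e => hy (e ▸ hx)
      simp only [disjoint_insert_left, disjoint_singleton_left, mem_insert, not_or]
      refine ⟨⟨ne h.hv h.n3, ne h.hv h.n1, ne h.hv h.n4, by simp [hK]⟩,
        ⟨ne h.hu h.n3, ne h.hu h.n1, ne h.hu h.n4, by simp [hK]⟩,
        ⟨ne hu' h.n3, ne hu' h.n1, ne hu' h.n4, by simp [hK]⟩,
        ⟨h.h23.ne, h.h12.ne', h.h24, fun hh => h.n2 (hKF hh)⟩⟩
  rcases h.adj_of_adj htri hu' huu' with hb | hb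
  · exact main c₂ c₄ h hb s2 s4
  · exact main c₄ c₂ h.reflect hb s4 s2

lemma false_of_forall_not_hasCore (h : IsTightConfig G F c₁ c₂ c₃ c₄ u v)
    (htri : ∀ a b c, G.Adj a b → G.Adj b c → ¬ G.Adj c a)
    (hFS : F ⊆ S) (s1 : c₁ ∈ S) (s2 : c₂ ∈ S) (s3 : c₃ ∈ S) (s4 : c₄ ∈ S)
    (hno : ∀ A ⊆ S, ∀ B ⊆ S, Disjoint A B → HasCore G A → ¬ HasCore G B) : False := by
  by_cases hv : ∀ w ∈ F, G.Adj v w → w = u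
  · exact h.false_of_pendant htri hFS s1 s2 s3 s4 hno hv
  by_cases hu : ∀ w ∈ F, G.Adj u w → w = v
  · exact h.rotate.false_of_pendant htri hFS s2 s3 s4 s1 hno hu
  push Not at hv hu
  obtain ⟨v', hv', hvv', hv'u⟩ := hv
  obtain ⟨u', hu', huu', hu'v⟩ := hu
  have main : ∀ a a' b b', IsTightConfig G F a b a' b' u v → G.Adj u' b → G.Adj v' a →
      a ∈ S → a' ∈ S → b ∈ S → b' ∈ S → False := by
    clear h
    intro a a' b b' h hub hva sa sa' sb sb'
    have ne : ∀ {x y}, x ∈ F → y ∉ F → x ≠ y := fun hx hy e => hy (e ▸ hx)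
    refine hno {u, u', b, a'} ?_ {v, v', a, b'} ?_ ?_
      (hasCore_four_cycle huu' hub h.h23 h.u3.symm (ne h.hu h.n2) (ne hu' h.n3))
      (hasCore_four_cycle hvv' hva h.h41.symm h.v4.symm (ne h.hv h.n1) (ne hv' h.n4))
    · simp only [insert_subset_iff, singleton_subset_iff]
      exact ⟨hFS h.hu, hFS hu', sb, sa'⟩
    · simp only [insert_subset_iff, singleton_subset_iff]
      exact ⟨hFS h.hv, hFS hv', sa, sb'⟩
    · have huv : u ≠ v := by
        rintro rfl; exact htri u a b h.u1 h.h12 h.v2.symm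
      have huv' : u' ≠ v' := by
        rintro rfl; exact htri u' a b hva h.h12 hub.symm
      simp only [disjoint_insert_left, disjoint_singleton_left, mem_insert, mem_singleton, not_or]
      exact ⟨⟨huv, hv'u.symm, ne h.hu h.n1, ne h.hu h.n4⟩,
        ⟨hu'v, huv', ne hu' h.n1, ne hu' h.n4⟩,
        ⟨(ne h.hv h.n2).symm, (ne hv' h.n2).symm, h.h12.ne', h.h24⟩,
        ⟨(ne h.hv h.n3).symm, (ne hv' h.n3).symm, h.h13.symm, h.h34.ne⟩⟩
  rcases h.adj_of_adj htri hu' huu' with hb | hb <;>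
  rcases h.rotate.adj_of_adj htri hv' hvv' with ha | ha
  · exact main c₃ c₁ c₂ c₄ h.reflect.rotate.rotate hb ha s3 s1 s2 s4
  · exact main c₁ c₃ c₂ c₄ h hb ha s1 s3 s2 s4
  · exact main c₃ c₁ c₄ c₂ h.rotate.rotate hb ha s3 s1 s4 s2
  · exact main c₁ c₃ c₄ c₂ h.reflect hb ha s1 s3 s4 s2

end IsTightConfig

lemma card_filter_common_le_one {F : Finset V} {x y : V}
    (hcom : (S.filter fun m => G.Adj x m ∧ G.Adj y m).card ≤ 3) (hFS : F ⊆ S) (ha : a ∈ S)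
    (hb : b ∈ S) (haF : a ∉ F) (hbF : b ∉ F) (hab : a ≠ b) (hxa : G.Adj x a) (hya : G.Adj y a)
    (hxb : G.Adj x b) (hyb : G.Adj y b) :
    (F.filter fun w => G.Adj w x ∧ G.Adj w y).card ≤ 1 := by
  have hsub : insert a (insert b (F.filter fun w => G.Adj w x ∧ G.Adj w y)) ⊆
      S.filter fun m => G.Adj x m ∧ G.Adj y m := by
    intro w
    simp only [mem_insert, mem_filter]
    rintro (rfl | rfl | ⟨h1, h2, h3⟩)
    · exact ⟨ha, hxa, hya⟩
    · exact ⟨hb, hxb, hyb⟩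
    · exact ⟨hFS h1, h2.symm, h3.symm⟩
  have := card_le_card hsub
  rw [card_insert_of_notMem (by simp [hab, haF]), card_insert_of_notMem (by simp [hbF])] at this
  omega

lemma false_of_four_cycle {c₁ c₂ c₃ c₄ : V}
    (htri : ∀ a b c, G.Adj a b → G.Adj b c → ¬ G.Adj c a)
    (hdeg : ∀ w ∈ S, 2 ≤ degIn G S w) (hsum : 4 ≤ ∑ w ∈ S, wt (degIn G S w))
    (hno : ∀ A ⊆ S, ∀ B ⊆ S, Disjoint A B → HasCore G A → ¬ HasCore G B)
    (hcom : ∀ x ∈ S, ∀ y ∈ S, x ≠ y → (S.filter fun m => G.Adj x m ∧ G.Adj y m).card ≤ 3)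
    (s1 : c₁ ∈ S) (s2 : c₂ ∈ S) (s3 : c₃ ∈ S) (s4 : c₄ ∈ S)
    (h12 : G.Adj c₁ c₂) (h23 : G.Adj c₂ c₃) (h34 : G.Adj c₃ c₄) (h41 : G.Adj c₄ c₁)
    (h13 : c₁ ≠ c₃) (h24 : c₂ ≠ c₄) : False := by
  have t2 : c₂ ∈ S.erase c₁ := by simp [s2, h12.ne']
  have t3 : c₃ ∈ (S.erase c₁).erase c₂ := by simp [s3, h13.symm, h23.ne']
  have t4 : c₄ ∈ ((S.erase c₁).erase c₂).erase c₃ := by simp [s4, h41.ne, h24.symm, h34.ne']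
  obtain ⟨F, hF⟩ : ∃ F, F = (((S.erase c₁).erase c₂).erase c₃).erase c₄ := ⟨_, rfl⟩
  have hFS : F ⊆ S := by
    intro w hw; simp only [hF, mem_erase] at hw; tauto
  have n1 : c₁ ∉ F := by simp [hF]
  have n2 : c₂ ∉ F := by simp [hF]
  have n3 : c₃ ∉ F := by simp [hF]
  have n4 : c₄ ∉ F := by simp [hF]
  have hd : ∀ w, degIn G S w = degIn G F w + (if G.Adj w c₄ then 1 else 0) +
      (if G.Adj w c₃ then 1 else 0) + (if G.Adj w c₂ then 1 else 0) +
      (if G.Adj w c₁ then 1 else 0) := by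
    intro w
    rw [degIn_erase s1, degIn_erase t2, degIn_erase t3, degIn_erase t4, hF]
  have hnF : ¬ HasCore G F := by
    refine hno {c₁, c₂, c₃, c₄} ?_ F hFS ?_ (hasCore_four_cycle h12 h23 h34 h41 h13 h24)
    · simp only [insert_subset_iff, singleton_subset_iff]
      exact ⟨s1, s2, s3, s4⟩
    · simp [n1, n2, n3, n4]
  have d1 : degIn G S c₁ = degIn G F c₁ + 2 := by
    rw [hd, if_pos h41.symm, if_pos h12, if_neg (fun h => htri c₁ c₂ c₃ h12 h23 h.symm),
      if_neg (G.irrefl)]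
  have d2 : degIn G S c₂ = degIn G F c₂ + 2 := by
    rw [hd, if_pos h12.symm, if_pos h23, if_neg (fun h => htri c₂ c₃ c₄ h23 h34 h.symm),
      if_neg (G.irrefl)]
  have d3 : degIn G S c₃ = degIn G F c₃ + 2 := by
    rw [hd, if_pos h23.symm, if_pos h34, if_neg (G.irrefl),
      if_neg (fun h => htri c₃ c₄ c₁ h34 h41 h.symm)]
  have d4 : degIn G S c₄ = degIn G F c₄ + 2 := by
    rw [hd, if_pos h34.symm, if_pos h41, if_neg (G.irrefl),
      if_neg (fun h => htri c₄ c₁ c₂ h41 h12 h.symm)]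
  rw [← add_sum_erase S _ s1, ← add_sum_erase _ _ t2, ← add_sum_erase _ _ t3,
    ← add_sum_erase _ _ t4, ← hF] at hsum
  have w1 := wt_le_one (degIn G S c₁)
  have w2 := wt_le_one (degIn G S c₂)
  have w3 := wt_le_one (degIn G S c₃)
  have w4 := wt_le_one (degIn G S c₄)
  have hFne : F.Nonempty := by
    rw [nonempty_iff_ne_empty]
    rintro rfl
    rw [sum_empty] at hsum
    have : wt (degIn G S c₁) = -1 := by rw [d1]; rfl
    omega
  have hFsum := sum_degIn_le hFne hnF
  have hA := card_filter_common_le_one (hcom c₁ s1 c₃ s3 h13) hFS s2 s4 n2 n4 h24 h12 h23.symm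
    h41.symm h34
  have hB := card_filter_common_le_one (hcom c₂ s2 c₄ s4 h24) hFS s3 s1 n3 n1 h13.symm h23
    h34.symm h12.symm h41
  have hne : ∀ w, ¬ (G.Adj w c₁ ∧ G.Adj w c₂) ∧ ¬ (G.Adj w c₂ ∧ G.Adj w c₃) ∧
      ¬ (G.Adj w c₃ ∧ G.Adj w c₄) ∧ ¬ (G.Adj w c₄ ∧ G.Adj w c₁) := fun w =>
    ⟨fun h => htri w c₁ c₂ h.1 h12 h.2.symm, fun h => htri w c₂ c₃ h.1 h23 h.2.symm,
      fun h => htri w c₃ c₄ h.1 h34 h.2.symm, fun h => htri w c₄ c₁ h.1 h41 h.2.symm⟩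
  have hle : ∀ w ∈ F, wt (degIn G S w) ≤ (degIn G F w : ℤ) - 2 +
      (if G.Adj w c₁ ∧ G.Adj w c₃ then 1 else 0) + (if G.Adj w c₂ ∧ G.Adj w c₄ then 1 else 0) := by
    intro w hw
    have h2 := hdeg w (hFS hw)
    have h3 := hne w
    rw [hd] at h2 ⊢
    unfold wt
    by_cases e1 : G.Adj w c₁ <;> by_cases e2 : G.Adj w c₂ <;> by_cases e3 : G.Adj w c₃ <;>
    by_cases e4 : G.Adj w c₄ <;> simp only [e1, e2, e3, e4, if_true, if_false, and_true, and_false,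
      not_true_eq_false, not_false_eq_true] at h2 h3 ⊢ <;> split_ifs <;> omega
  have hS := sum_le_sum hle
  have hSr : ∑ w ∈ F, ((degIn G F w : ℤ) - 2 + (if G.Adj w c₁ ∧ G.Adj w c₃ then 1 else 0) +
      (if G.Adj w c₂ ∧ G.Adj w c₄ then 1 else 0)) = ((∑ w ∈ F, degIn G F w : ℕ) : ℤ) -
      2 * F.card + (F.filter fun w => G.Adj w c₁ ∧ G.Adj w c₃).card +
      (F.filter fun w => G.Adj w c₂ ∧ G.Adj w c₄).card := by
    rw [sum_add_distrib, sum_add_distrib, sum_sub_distrib, sum_boole, sum_boole]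
    simp [mul_comm]
  have heq := (sum_eq_sum_iff_of_le hle).mp (by omega)
  obtain ⟨u, hu⟩ := card_eq_one.mp
    (show (F.filter fun w => G.Adj w c₁ ∧ G.Adj w c₃).card = 1 by omega)
  obtain ⟨v, hv⟩ := card_eq_one.mp
    (show (F.filter fun w => G.Adj w c₂ ∧ G.Adj w c₄).card = 1 by omega)
  have hsumF : ∑ w ∈ F, degIn G F w + 2 = 2 * F.card := by omega
  have hu' : ∀ w, (w ∈ F ∧ G.Adj w c₁ ∧ G.Adj w c₃) ↔ w = u := fun w => by
    simpa using Finset.ext_iff.mp hu w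
  have hv' : ∀ w, (w ∈ F ∧ G.Adj w c₂ ∧ G.Adj w c₄) ↔ w = v := fun w => by
    simpa using Finset.ext_iff.mp hv w
  obtain ⟨hu1, hu2, hu3⟩ := (hu' u).mpr rfl
  obtain ⟨hv1, hv2, hv3⟩ := (hv' v).mpr rfl
  have wt1 : ∀ d, wt (d + 2) = 1 → 2 ≤ d := by
    intro d h
    unfold wt at h
    split_ifs at h <;> omega
  have hcase : ∀ w ∈ F, degIn G F w ≤ 3 ∧
      (G.Adj w c₁ ∨ G.Adj w c₂ ∨ G.Adj w c₃ ∨ G.Adj w c₄) ∧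
      ((G.Adj w c₁ ∧ G.Adj w c₃) ∨ (G.Adj w c₂ ∧ G.Adj w c₄) → degIn G F w ≤ 2) := by
    intro w hw
    have h1 := heq w hw
    have h2 := hdeg w (hFS hw)
    have h3 := hne w
    rw [hd] at h1 h2
    unfold wt at h1
    by_cases e1 : G.Adj w c₁ <;> by_cases e2 : G.Adj w c₂ <;> by_cases e3 : G.Adj w c₃ <;>
    by_cases e4 : G.Adj w c₄ <;> simp only [e1, e2, e3, e4, if_true, if_false, and_self, and_true,
      true_and, and_false, or_self, or_true, or_false, not_true_eq_false, not_false_eq_true,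
      true_implies, false_implies] at h1 h2 h3 ⊢ <;> split_ifs at h1 <;> omega
  have hpos : ∀ w ∈ F, ∀ x ∈ F, w ≠ x → 1 ≤ degIn G F w := by
    intro w hw x hx hwx
    by_contra hlt
    have e := sum_degIn_erase (G := G) hw
    have f := card_erase_add_one hw
    refine hnF ((hasCore_of_sum (S := F.erase w) ⟨x, by simp [hx, hwx.symm]⟩ ?_).mono
      (erase_subset _ _))
    omega
  have huv : u ≠ v := by
    rintro rfl
    exact (hne u).1 ⟨hu2, hv2⟩
  have config : IsTightConfig G F c₁ c₂ c₃ c₄ u v :=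
    { h12, h23, h34, h41, h13, h24, n1, n2, n3, n4, hu := hu1, hv := hv1, u1 := hu2, u3 := hu3
      v2 := hv2, v4 := hv3
      u_unique := fun w hw h1 h3 => (hu' w).mp ⟨hw, h1, h3⟩
      v_unique := fun w hw h1 h3 => (hv' w).mp ⟨hw, h1, h3⟩
      sum_eq := hsumF
      d1 := wt1 _ (by rw [← d1]; omega)
      d2 := wt1 _ (by rw [← d2]; omega)
      d3 := wt1 _ (by rw [← d3]; omega)
      d4 := wt1 _ (by rw [← d4]; omega)
      degIn_le := fun w hw => (hcase w hw).1
      exists_adj := fun w hw => (hcase w hw).2.1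
      du := (hcase u hu1).2.2 (.inl ⟨hu2, hu3⟩)
      dv := (hcase v hv1).2.2 (.inr ⟨hv2, hv3⟩)
      du' := hpos u hu1 v hv1 huv
      dv' := hpos v hv1 u hu1 huv.symm }
  exact config.false_of_forall_not_hasCore htri hFS s1 s2 s3 s4 hno

lemma false_of_four_common {x y : V}
    (htri : ∀ a b c, G.Adj a b → G.Adj b c → ¬ G.Adj c a)
    (hdeg : ∀ w ∈ S, 2 ≤ degIn G S w) (hsum : 4 ≤ ∑ w ∈ S, wt (degIn G S w))
    (hno : ∀ A ⊆ S, ∀ B ⊆ S, Disjoint A B → HasCore G A → ¬ HasCore G B)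
    (hx : x ∈ S) (hy : y ∈ S) (hxy : x ≠ y)
    (hM : 4 ≤ (S.filter fun m => G.Adj x m ∧ G.Adj y m).card) : False := by
  obtain ⟨M, hMdef⟩ : ∃ M, M = S.filter fun m => G.Adj x m ∧ G.Adj y m := ⟨_, rfl⟩
  rw [← hMdef] at hM
  have hMx : ∀ m ∈ M, G.Adj x m := fun m hm => by rw [hMdef, mem_filter] at hm; exact hm.2.1
  have hMy : ∀ m ∈ M, G.Adj y m := fun m hm => by rw [hMdef, mem_filter] at hm; exact hm.2.2
  have hyS : y ∈ S.erase x := by simp [hy, hxy.symm]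
  obtain ⟨R, hRdef⟩ : ∃ R, R = (S.erase x).erase y := ⟨_, rfl⟩
  have hRS : R ⊆ S := by rw [hRdef]; exact (erase_subset _ _).trans (erase_subset _ _)
  have hxR : x ∉ R := by simp [hRdef]
  have hyR : y ∉ R := by simp [hRdef]
  have hMR : M ⊆ R := by
    intro m hm
    have h1 := hMx m hm
    have h2 := hMy m hm
    rw [hMdef, mem_filter] at hm
    simp [hRdef, h1.ne', h2.ne', hm.1]
  have hd : ∀ w, degIn G S w = degIn G R w + (if G.Adj w y then 1 else 0) +
      (if G.Adj w x then 1 else 0) := by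
    intro w
    rw [degIn_erase hx, degIn_erase hyS, hRdef]
  have hR : 2 ≤ ∑ w ∈ R, wt (degIn G S w) := by
    rw [← add_sum_erase S _ hx, ← add_sum_erase _ _ hyS, ← hRdef] at hsum
    have := wt_le_one (degIn G S x)
    have := wt_le_one (degIn G S y)
    omega
  have hmem : ∀ w ∈ R, G.Adj w x → G.Adj w y → w ∈ M := fun w hw h1 h2 => by
    rw [hMdef, mem_filter]
    exact ⟨hRS hw, h1.symm, h2.symm⟩
  by_cases hcore : HasCore G R
  swap
  · have hle : ∀ w ∈ R, wt (degIn G S w) ≤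
        wt (degIn G R w + (1 + if w ∈ M then 1 else 0)) := by
      intro w hw
      apply wt_mono
      have := hmem w hw
      rw [hd]
      split_ifs <;> first | omega | tauto
    obtain ⟨P, Q, hP, hQ, hPQ, lP, lQ⟩ :=
      exists_disjoint_links hcore (hR.trans (sum_le_sum hle))
    refine hno (insert x P) (insert_subset hx (hP.trans hRS)) (insert y Q)
      (insert_subset hy (hQ.trans hRS)) ?_ (lP.hasCore (fun h => hxR (hP h)) hMx)
      (lQ.hasCore (fun h => hyR (hQ h)) hMy)
    rw [disjoint_insert_left, disjoint_insert_right]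
    refine ⟨?_, fun h => hyR (hP h), hPQ⟩
    rw [mem_insert, not_or]
    exact ⟨hxy, fun h => hxR (hQ h)⟩
  obtain ⟨D, hDR, hDne, hDdeg⟩ := hcore
  have hindep : ∀ m ∈ M, ∀ m' ∈ M, ¬ G.Adj m m' := fun m hm m' hm' h =>
    htri x m m' (hMx m hm) h (hMx m' hm').symm
  have hcore2 : ∀ m ∈ M, ∀ m' ∈ M, m ≠ m' → ∀ A ⊆ R, m ∉ A → m' ∉ A → ¬ HasCore G A := by
    intro m hm m' hm' hne A hA h1 h2
    refine hno {x, m, y, m'} ?_ A (hA.trans hRS) ?_ (hasCore_four_cycle (hMx m hm) (hMy m hm).symm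
      (hMy m' hm') (hMx m' hm').symm hxy hne)
    · simp only [insert_subset_iff, singleton_subset_iff]
      exact ⟨hx, hRS (hMR hm), hy, hRS (hMR hm')⟩
    · simp only [disjoint_insert_left, disjoint_singleton_left]
      exact ⟨fun h => hxR (hA h), h1, fun h => hyR (hA h), h2⟩
  have hpair : ∀ m ∈ M, ∀ m' ∈ M, m ≠ m' →
      ∑ w ∈ R, degIn G R w + 6 ≤ 2 * R.card + 2 * degIn G R m + 2 * degIn G R m' := by
    intro m hm m' hm' hne
    have hm'R : m' ∈ R.erase m := by simp [hMR hm', hne.symm]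
    have e1 := sum_degIn_erase (G := G) (hMR hm)
    have e2 := sum_degIn_erase (G := G) hm'R
    have f1 := card_erase_add_one (hMR hm)
    have f2 := card_erase_add_one hm'R
    have e3 := degIn_erase (G := G) (hMR hm) m'
    rw [if_neg (hindep m' hm' m hm)] at e3
    have hne : ((R.erase m).erase m').Nonempty := by
      rw [← card_pos]
      have := card_le_card hMR
      omega
    have := sum_degIn_le (G := G) hne (hcore2 m hm m' hm' ‹_› _
      ((erase_subset _ _).trans (erase_subset _ _)) (by simp) (by simp))
    omega
  obtain ⟨N, hN⟩ : ∃ N : V → Finset V, N = fun m => R.filter fun w => G.Adj m w := ⟨_, rfl⟩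
  have hNm : ∀ {m w}, w ∈ N m ↔ w ∈ R ∧ G.Adj m w := by simp [hN]
  have hNc : ∀ m, (N m).card = degIn G R m := fun m => by rw [hN]; rfl
  have hNM : ∀ m ∈ M, ∀ w ∈ N m, w ∉ M := fun m hm w hw hwM =>
    hindep m hm w hwM (hNm.mp hw).2
  have hlin : ∀ m ∈ M, ∀ m' ∈ M, m ≠ m' → ∀ p q, p ∈ N m → p ∈ N m' → q ∈ N m → q ∈ N m' →
      p = q := by
    intro m hm m' hm' hne p q hp hp' hq hq'
    by_contra hpq
    have hcard : 1 < ((M.erase m).erase m').card := by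
      rw [card_erase_of_mem (by simp [hm', hne.symm]), card_erase_of_mem hm]
      omega
    obtain ⟨a, ha, b, hb, hab⟩ := one_lt_card.mp hcard
    simp only [mem_erase] at ha hb
    have hpM := hNM m hm p hp
    have hqM := hNM m hm q hq
    refine hcore2 a ha.2.2 b hb.2.2 hab {m, p, m', q} ?_ ?_ ?_ (hasCore_four_cycle
      (hNm.mp hp).2 (hNm.mp hp').2.symm (hNm.mp hq').2 (hNm.mp hq).2.symm hne hpq)
    · simp only [insert_subset_iff, singleton_subset_iff]
      exact ⟨hMR hm, (hNm.mp hp).1, hMR hm', (hNm.mp hq).1⟩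
    · simp only [mem_insert, mem_singleton, not_or]
      exact ⟨ha.2.1, fun h => hpM (h ▸ ha.2.2), ha.1, fun h => hqM (h ▸ ha.2.2)⟩
    · simp only [mem_insert, mem_singleton, not_or]
      exact ⟨hb.2.1, fun h => hpM (h ▸ hb.2.2), hb.1, fun h => hqM (h ▸ hb.2.2)⟩
  have hfour : ∀ m₁ ∈ M, ∀ m₂ ∈ M, ∀ m₃ ∈ M, ∀ m₄ ∈ M, m₁ ≠ m₂ → m₁ ≠ m₃ → m₁ ≠ m₄ → m₂ ≠ m₃ →
      m₂ ≠ m₄ → m₃ ≠ m₄ → ∀ p q, p ∈ N m₁ → p ∈ N m₂ → q ∈ N m₃ → q ∈ N m₄ → p = q := by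
    intro m₁ h1 m₂ h2 m₃ h3 m₄ h4 h12 h13 h14 h23 h24 h34 p q hp1 hp2 hq3 hq4
    by_contra hpq
    have hpM := hNM m₁ h1 p hp1
    have hqM := hNM m₃ h3 q hq3
    have ne : ∀ {x y} {A : Finset V}, x ∈ A → y ∉ A → x ≠ y := fun hx hy e => hy (e ▸ hx)
    rw [hNm] at hp1 hp2 hq3 hq4
    refine hno {x, m₁, p, m₂} ?_ {y, m₃, q, m₄} ?_ ?_
      (hasCore_four_cycle (hMx m₁ h1) hp1.2 hp2.2.symm (hMx m₂ h2).symm (ne hp1.1 hxR).symm h12)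
      (hasCore_four_cycle (hMy m₃ h3) hq3.2 hq4.2.symm (hMy m₄ h4).symm (ne hq3.1 hyR).symm h34)
    · simp only [insert_subset_iff, singleton_subset_iff]
      exact ⟨hx, hRS (hMR h1), hRS hp1.1, hRS (hMR h2)⟩
    · simp only [insert_subset_iff, singleton_subset_iff]
      exact ⟨hy, hRS (hMR h3), hRS hq3.1, hRS (hMR h4)⟩
    · simp only [disjoint_insert_left, disjoint_singleton_left, mem_insert, mem_singleton, not_or]
      exact ⟨⟨hxy, (hMx m₃ h3).ne, (ne hq3.1 hxR).symm, (hMx m₄ h4).ne⟩,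
        ⟨(hMy m₁ h1).ne', h13, ne h1 hqM, h14⟩,
        ⟨ne hp1.1 hyR, (ne h3 hpM).symm, hpq, (ne h4 hpM).symm⟩,
        ⟨(hMy m₂ h2).ne', h23, ne h2 hqM, h24⟩⟩
  obtain ⟨U, hU⟩ : ∃ U, U = M.biUnion N := ⟨_, rfl⟩
  have hUR : U ⊆ R := by
    rw [hU, biUnion_subset]
    exact fun m _ w hw => (hNm.mp hw).1
  have hle : ∀ w ∈ R, wt (degIn G S w) ≤ (degIn G R w : ℤ) - 2 +
      (if w ∈ M then min 1 (3 - (degIn G R w : ℤ)) else 0) - (if w ∈ U then 1 else 0) := by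
    intro w hw
    have h2 := hdeg w (hRS hw)
    have hUw : w ∈ U → w ∉ M ∧ ¬ G.Adj w x ∧ ¬ G.Adj w y := by
      intro h
      rw [hU, mem_biUnion] at h
      obtain ⟨m, hm, hw⟩ := h
      exact ⟨hNM m hm w hw, fun h => htri x m w (hMx m hm) (hNm.mp hw).2 h,
        fun h => htri y m w (hMy m hm) (hNm.mp hw).2 h⟩
    have hMw : w ∈ M → G.Adj w x ∧ G.Adj w y := fun h => ⟨(hMx w h).symm, (hMy w h).symm⟩
    have hm := hmem w hw
    rw [hd] at h2 ⊢
    clear * - h2 hUw hMw hm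
    unfold wt
    by_cases e1 : w ∈ M <;> by_cases e2 : w ∈ U <;> by_cases e3 : G.Adj w x <;>
    by_cases e4 : G.Adj w y <;> simp only [e1, e2, e3, e4] at h2 hUw hMw hm ⊢ <;>
    simp at h2 hUw hMw hm ⊢ <;> split_ifs <;> omega
  have hS := sum_le_sum hle
  have hSr : ∑ w ∈ R, ((degIn G R w : ℤ) - 2 +
      (if w ∈ M then min 1 (3 - (degIn G R w : ℤ)) else 0) - (if w ∈ U then 1 else 0)) =
      ((∑ w ∈ R, degIn G R w : ℕ) : ℤ) - 2 * R.card +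
      ∑ m ∈ M, min 1 (3 - (degIn G R m : ℤ)) - U.card := by
    rw [sum_sub_distrib, sum_add_distrib, sum_sub_distrib, sum_boole, sum_ite_mem,
      inter_eq_right.mpr hMR, filter_mem_eq_inter, inter_eq_right.mpr hUR]
    simp [mul_comm]
  obtain ⟨m₁, hm₁, hmin₁⟩ := exists_min_image M (degIn G R) (card_pos.mp (by omega))
  have hc1 := card_erase_add_one hm₁
  obtain ⟨m₂, hm₂, hmin₂⟩ := exists_min_image (M.erase m₁) (degIn G R) (card_pos.mp (by omega))
  have hc2 := card_erase_add_one hm₂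
  have hm₂' := mem_erase.mp hm₂
  have hp := hpair m₁ hm₁ m₂ hm₂'.2 hm₂'.1.symm
  have h12 := hmin₁ m₂ hm₂'.2
  have hrest : ∑ m ∈ (M.erase m₁).erase m₂, min 1 (3 - (degIn G R m : ℤ)) ≤
      ((M.erase m₁).erase m₂).card * min 1 (3 - (degIn G R m₂ : ℤ)) := by
    rw [← nsmul_eq_mul]
    refine sum_le_card_nsmul _ _ _ fun m hm => ?_
    have := hmin₂ m (mem_of_mem_erase hm)
    omega
  rw [← add_sum_erase M _ hm₁, ← add_sum_erase _ _ hm₂] at hSr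
  obtain ⟨r, hr⟩ : ∃ r, r = ((M.erase m₁).erase m₂).card := ⟨_, rfl⟩
  rw [← hr] at hrest hc2
  by_cases hd1 : 2 ≤ degIn G R m₁
  · have hcomb := card_biUnion_of_linear (M := M) (N := N)
      (fun m hm => by rw [hNc]; exact hd1.trans (hmin₁ m hm)) hlin hfour
    rw [← hU] at hcomb
    by_cases hd2 : degIn G R m₂ ≤ 2
    · rw [min_eq_left (a := (1 : ℤ)) (b := 3 - (degIn G R m₂ : ℤ)) (by omega)] at hrest
      omega
    · have : (r : ℤ) * min 1 (3 - (degIn G R m₂ : ℤ)) ≤ 2 * (3 - (degIn G R m₂ : ℤ)) := by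
        rw [min_eq_right (by omega)]
        exact mul_le_mul_of_nonpos_right (by omega) (by omega)
      omega
  · have hm₁D : m₁ ∉ D := fun h => hd1 ((hDdeg m₁ h).trans (degIn_mono hDR m₁))
    have hD : ∀ m ∈ M.erase m₁, 2 ≤ degIn G R m := by
      intro m hm
      rw [mem_erase] at hm
      by_contra hlt
      exact hcore2 m₁ hm₁ m hm.2 hm.1.symm D hDR hm₁D
        (fun h => hlt ((hDdeg m h).trans (degIn_mono hDR m))) ⟨D, Subset.rfl, hDne, hDdeg⟩
    have he : ∀ {m}, m ∈ M.erase m₁ → m ∈ M := fun h => mem_of_mem_erase h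
    have hcomb := card_biUnion_of_linear (M := M.erase m₁) (N := N)
      (fun m hm => by rw [hNc]; exact hD m hm)
      (fun m hm m' hm' => hlin m (he hm) m' (he hm'))
      (fun a ha b hb c hc d hd => hfour a (he ha) b (he hb) c (he hc) d (he hd))
    have hUle := card_le_card (biUnion_subset_biUnion_of_subset_left N (erase_subset m₁ M))
    rw [← hU] at hUle
    by_cases hd2 : degIn G R m₂ ≤ 2
    · rw [min_eq_left (a := (1 : ℤ)) (b := 3 - (degIn G R m₂ : ℤ)) (by omega)] at hrest
      omega
    · have : (r : ℤ) * min 1 (3 - (degIn G R m₂ : ℤ)) ≤ 2 * (3 - (degIn G R m₂ : ℤ)) := by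
        rw [min_eq_right (by omega)]
        exact mul_le_mul_of_nonpos_right (by omega) (by omega)
      omega

lemma exists_disjoint_hasCore (htri : ∀ a b c, G.Adj a b → G.Adj b c → ¬ G.Adj c a)
    (hsum : 4 ≤ ∑ w ∈ S, wt (degIn G S w)) :
    ∃ A ⊆ S, ∃ B ⊆ S, Disjoint A B ∧ HasCore G A ∧ HasCore G B := by
  induction hn : S.card generalizing G S with
  | zero =>
    rw [card_eq_zero] at hn
    simp [hn] at hsum
  | succ n ih =>
    by_cases hdeg : ∀ w ∈ S, 2 ≤ degIn G S w
    swap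
    · push Not at hdeg
      obtain ⟨v, hv, hlt⟩ := hdeg
      have h := sum_wt_erase (G := G) (fun _ => 0) hv (by omega) (by omega)
      simp only [add_zero] at h
      obtain ⟨A, hA, B, hB, hAB⟩ := ih htri (hsum.trans h)
        (by rw [card_erase_of_mem hv]; omega)
      exact ⟨A, hA.trans (erase_subset _ _), B, hB.trans (erase_subset _ _), hAB⟩
    by_contra hcon
    have hno : ∀ A ⊆ S, ∀ B ⊆ S, Disjoint A B → HasCore G A → ¬ HasCore G B :=
      fun A hA B hB hAB h1 h2 => hcon ⟨A, hA, B, hB, hAB, h1, h2⟩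
    have hcom : ∀ x ∈ S, ∀ y ∈ S, x ≠ y →
        (S.filter fun m => G.Adj x m ∧ G.Adj y m).card ≤ 3 := by
      intro x hx y hy hxy
      by_contra hlt
      exact false_of_four_common htri hdeg hsum hno hx hy hxy (by omega)
    have h4 : ∀ a ∈ S, ∀ b ∈ S, ∀ c ∈ S, ∀ d ∈ S, G.Adj a b → G.Adj b c → G.Adj c d →
        G.Adj d a → a ≠ c → b = d := by
      intro a ha b hb c hc d hd hab hbc hcd hda hac
      by_contra hbd
      exact false_of_four_cycle htri hdeg hsum hno hcom ha hb hc hd hab hbc hcd hda hac hbd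
    obtain ⟨u, hu, hd⟩ : ∃ u ∈ S, degIn G S u ≤ 3 ∨ ∀ w ∈ S, 4 ≤ degIn G S w := by
      by_cases h : ∃ u ∈ S, degIn G S u ≤ 3
      · obtain ⟨u, hu, h⟩ := h
        exact ⟨u, hu, .inl h⟩
      · push Not at h
        obtain ⟨u, hu⟩ := card_pos.mp (show 0 < S.card by omega)
        exact ⟨u, hu, .inr h⟩
    obtain ⟨v, hv, huv⟩ := exists_adj_of_degIn_pos (one_le_two.trans (hdeg u hu))
    obtain ⟨htri', hsum'⟩ := contractOnto_spec htri h4 hu hv huv hdeg hsum hd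
    obtain ⟨A, hA, B, hB, hAB, cA, cB⟩ := ih htri' hsum' (by rw [card_erase_of_mem hv]; omega)
    have hvR : v ∉ S.erase v := by simp
    have huR : u ∈ S.erase v := by simp [hu, huv.ne]
    have lift : ∀ T ⊆ S.erase v, (if u ∈ T then insert v T else T) ⊆ S := by
      intro T hT
      split_ifs
      · exact insert_subset hv (hT.trans (erase_subset _ _))
      · exact hT.trans (erase_subset _ _)
    refine hno _ (lift A hA) _ (lift B hB) ?_ (cA.of_contractOnto hvR huR huv hA)
      (cB.of_contractOnto hvR huR huv hB)
    have hvA : v ∉ A := fun h => hvR (hA h)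
    have hvB : v ∉ B := fun h => hvR (hB h)
    split_ifs with h1 h2
    · exact absurd h2 (disjoint_left.mp hAB h1)
    · exact disjoint_insert_left.mpr ⟨hvB, hAB⟩
    · exact disjoint_insert_right.mpr ⟨hvA, hAB⟩
    · exact hAB

lemma hasDisjointCycles_two_of_hasCore {A B : Finset V} (hAB : Disjoint A B) (hA : HasCore G A)
    (hB : HasCore G B) : HasDisjointCycles G 2 := by
  have key : ∀ i : Fin 2, ∃ (v : V) (p : G.Walk v v), p.IsCycle ∧ ∀ x ∈ p.support, x ∈ ![A, B] i := by
    intro i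
    fin_cases i
    · exact hA.exists_cycle
    · exact hB.exists_cycle
  choose v c hc hs using key
  refine ⟨v, c, hc, ?_⟩
  intro i j hij x hi hj
  have h1 := hs i x hi
  have h2 := hs j x hj
  fin_cases i <;> fin_cases j
  · exact hij rfl
  · exact disjoint_left.mp hAB h1 h2
  · exact disjoint_left.mp hAB h2 h1
  · exact hij rfl

lemma degIn_univ [Fintype V] (G : SimpleGraph V) [DecidableRel G.Adj] (v : V) :
    degIn G univ v = G.degree v := by
  rw [degIn, ← SimpleGraph.card_neighborFinset_eq_degree, SimpleGraph.neighborFinset_eq_filter]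
  congr

lemma sum_wt_degree [Fintype V] (G : SimpleGraph V) [DecidableRel G.Adj] :
    ∑ v, wt (degIn G univ v) = ((Hset G 2).card : ℤ) - (Lset G 2).card := by
  rw [Hset, Lset, ← sum_boole, ← sum_boole, ← sum_sub_distrib]
  refine sum_congr rfl fun v _ => ?_
  rw [degIn_univ, wt]
  split_ifs <;> omega

end

theorem triangle_free_two_cycles {V : Type*} [Fintype V] (G : SimpleGraph V)
    [DecidableRel G.Adj] (htf : G.CliqueFree 3)
    (hHL : (Lset G 2).card + 4 ≤ (Hset G 2).card) :
    HasDisjointCycles G 2 := by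
  classical
  obtain ⟨A, -, B, -, hAB, hA, hB⟩ := exists_disjoint_hasCore (G := G) (S := univ)
    (fun a b c hab hbc hca => htf {a, b, c}
      (SimpleGraph.is3Clique_triple_iff.mpr ⟨hab, hca.symm, hbc⟩))
    (by rw [sum_wt_degree]; omega)
  exact hasDisjointCycles_two_of_hasCore hAB hA hB
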